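/- There exist real numbers H₁ > 0 and H₂ > 0 such that 2π ∫₀^∞ ( H₁² + 1/4 − ((r²−1)/(r²+1))² ) · ( 16(1+4H₁²)(1+r²)² / ((r²−1)² + 4H₁²(r²+1)²)² ) · r dr ≠ 2π ∫₀^∞ ( H₂² + 1/4 − ((r²−1)/(r²+1))² ) · ( 16(1+4H₂²)(1+r²)² / ((r²−1)² + 4H₂²(r²+1)²)² ) · r dr. -/

import Mathlib

open MeasureTheory Real Set

/-- Stereographic height: the function `r ↦ (r² - 1) / (r² + 1)` has derivative
`4 r / (r² + 1)²`. -/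
lemma hasDerivAt_stereoHeight (r : ℝ) :
    HasDerivAt (fun r : ℝ ↦ (r ^ 2 - 1) / (r ^ 2 + 1)) (4 * r / (r ^ 2 + 1) ^ 2) r := by
  have h : r ^ 2 + 1 ≠ 0 := by positivity
  have h₁ := ((hasDerivAt_pow 2 r).sub_const 1).fun_div ((hasDerivAt_pow 2 r).add_const 1) h
  refine h₁.congr_deriv ?_
  field_simp
  push_cast
  ring

lemma tendsto_stereoHeight_atTop :
    Filter.Tendsto (fun r : ℝ ↦ (r ^ 2 - 1) / (r ^ 2 + 1)) Filter.atTop (nhds 1) := by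
  have h : Filter.Tendsto (fun r : ℝ ↦ r ^ 2 + 1) Filter.atTop Filter.atTop :=
    Filter.tendsto_atTop_add_const_right _ _ (Filter.tendsto_pow_atTop two_ne_zero)
  have h₁ := (h.inv_tendsto_atTop.const_mul 2).const_sub 1
  simp only [mul_zero, sub_zero] at h₁
  refine h₁.congr fun r ↦ ?_
  have : r ^ 2 + 1 ≠ 0 := by positivity
  simp only [Pi.inv_apply]
  field_simp
  ring

lemma stereoHeight_mem_Icc (r : ℝ) : (r ^ 2 - 1) / (r ^ 2 + 1) ∈ Icc (-1 : ℝ) 1 := by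
  have : 0 < r ^ 2 + 1 := by positivity
  constructor
  · rw [le_div_iff₀ this]
    nlinarith [sq_nonneg r]
  · rw [div_le_one this]
    linarith

/-- Substituting the stereographic height turns a radial integral into one over `[-1, 1]`. -/
lemma integral_Ioi_comp_stereoHeight {G g : ℝ → ℝ} (hG : ∀ x, HasDerivAt G (g x) x)
    (hg : Continuous g) :
    ∫ r in Ioi (0 : ℝ), g ((r ^ 2 - 1) / (r ^ 2 + 1)) * (4 * r / (r ^ 2 + 1) ^ 2) =
      G 1 - G (-1) := by
  have hcont : Continuous fun r : ℝ ↦ (r ^ 2 - 1) / (r ^ 2 + 1) :=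
    continuous_iff_continuousAt.2 fun r ↦ (hasDerivAt_stereoHeight r).continuousAt
  have hu : IntegrableOn (fun r : ℝ ↦ 4 * r / (r ^ 2 + 1) ^ 2) (Ioi 0) :=
    integrableOn_Ioi_deriv_of_nonneg hcont.continuousWithinAt
      (fun r _ ↦ hasDerivAt_stereoHeight r)
      (fun r hr ↦ by have : 0 < r := hr; positivity) tendsto_stereoHeight_atTop
  obtain ⟨C, hC⟩ := isCompact_Icc.exists_bound_of_continuousOn (s := Icc (-1 : ℝ) 1) hg.continuousOn
  have hint : IntegrableOn
      (fun r : ℝ ↦ g ((r ^ 2 - 1) / (r ^ 2 + 1)) * (4 * r / (r ^ 2 + 1) ^ 2)) (Ioi 0) :=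
    Integrable.bdd_mul hu (hg.comp hcont).aestronglyMeasurable
      (Filter.Eventually.of_forall fun r ↦ hC _ (stereoHeight_mem_Icc r))
  have hderiv (r : ℝ) : HasDerivAt (fun r : ℝ ↦ G ((r ^ 2 - 1) / (r ^ 2 + 1)))
      (g ((r ^ 2 - 1) / (r ^ 2 + 1)) * (4 * r / (r ^ 2 + 1) ^ 2)) r :=
    (hG _).comp r (hasDerivAt_stereoHeight r)
  have h := integral_Ioi_of_hasDerivAt_of_tendsto (hderiv 0).continuousAt.continuousWithinAt
    (fun r _ ↦ hderiv r) hint ((hG 1).continuousAt.tendsto.comp tendsto_stereoHeight_atTop)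
  rw [h]
  norm_num

/-- In terms of the stereographic height `u`, the Willmore integrand of `S_H` is a rational
function of `u` times `du`. -/
lemma willmore_integrand_eq {H : ℝ} (hH : 0 < H) (r : ℝ) :
    (H ^ 2 + 1 / 4 - ((r ^ 2 - 1) / (r ^ 2 + 1)) ^ 2) *
        (16 * (1 + 4 * H ^ 2) * (1 + r ^ 2) ^ 2 /
          ((r ^ 2 - 1) ^ 2 + 4 * H ^ 2 * (r ^ 2 + 1) ^ 2) ^ 2) * r =
      (1 + 4 * H ^ 2) * (1 + 4 * H ^ 2 - 4 * ((r ^ 2 - 1) / (r ^ 2 + 1)) ^ 2) /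
        (((r ^ 2 - 1) / (r ^ 2 + 1)) ^ 2 + 4 * H ^ 2) ^ 2 * (4 * r / (r ^ 2 + 1) ^ 2) := by
  have h₁ : r ^ 2 + 1 ≠ 0 := by positivity
  have h₂ : (r ^ 2 - 1) ^ 2 + 4 * H ^ 2 * (r ^ 2 + 1) ^ 2 ≠ 0 := by positivity
  have h₃ : ((r ^ 2 - 1) / (r ^ 2 + 1)) ^ 2 + 4 * H ^ 2 =
      ((r ^ 2 - 1) ^ 2 + 4 * H ^ 2 * (r ^ 2 + 1) ^ 2) / (r ^ 2 + 1) ^ 2 := by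
    field_simp
  rw [h₃]
  field_simp
  ring

/-- The Willmore integral of `S_H`, evaluated through an antiderivative in the stereographic
height. -/
lemma willmore_integral_eq {H : ℝ} (hH : 0 < H) {G : ℝ → ℝ}
    (hG : ∀ u, HasDerivAt G
      ((1 + 4 * H ^ 2) * (1 + 4 * H ^ 2 - 4 * u ^ 2) / (u ^ 2 + 4 * H ^ 2) ^ 2) u) :
    ∫ r in Ioi (0 : ℝ), (H ^ 2 + 1 / 4 - ((r ^ 2 - 1) / (r ^ 2 + 1)) ^ 2) *
        (16 * (1 + 4 * H ^ 2) * (1 + r ^ 2) ^ 2 /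
          ((r ^ 2 - 1) ^ 2 + 4 * H ^ 2 * (r ^ 2 + 1) ^ 2) ^ 2) * r = G 1 - G (-1) := by
  simp only [willmore_integrand_eq hH]
  refine integral_Ioi_comp_stereoHeight hG (Continuous.div (by fun_prop) (by fun_prop) fun u ↦ ?_)
  positivity

/-- When `H = 1 / 2` the Willmore integrand has an elementary antiderivative. -/
lemma hasDerivAt_willmore_antideriv_half (u : ℝ) :
    HasDerivAt (fun u : ℝ ↦ 6 * (u / (u ^ 2 + 1)) - 2 * arctan u)
      ((1 + 4 * (1 / 2 : ℝ) ^ 2) * (1 + 4 * (1 / 2 : ℝ) ^ 2 - 4 * u ^ 2) /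
        (u ^ 2 + 4 * (1 / 2 : ℝ) ^ 2) ^ 2) u := by
  have h : u ^ 2 + 1 ≠ 0 := by positivity
  have h₁ := (((hasDerivAt_id' u).fun_div ((hasDerivAt_pow 2 u).add_const 1) h).const_mul 6).fun_sub
    ((hasDerivAt_arctan u).const_mul 2)
  refine h₁.congr_deriv ?_
  norm_num
  rw [add_comm 1 (u ^ 2)]
  field_simp
  ring

/-- When `H² = 1 / 12` the Willmore integrand has a rational antiderivative. -/
lemma hasDerivAt_willmore_antideriv_twelfth {H : ℝ} (hH : H ^ 2 = 1 / 12) (u : ℝ) :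
    HasDerivAt (fun u : ℝ ↦ 16 / 3 * (u / (u ^ 2 + 1 / 3)))
      ((1 + 4 * H ^ 2) * (1 + 4 * H ^ 2 - 4 * u ^ 2) / (u ^ 2 + 4 * H ^ 2) ^ 2) u := by
  have h : u ^ 2 + 1 / 3 ≠ 0 := by positivity
  have h₁ := ((hasDerivAt_id' u).fun_div ((hasDerivAt_pow 2 u).add_const (1 / 3)) h).const_mul
    (16 / 3)
  refine h₁.congr_deriv ?_
  rw [hH, show (4 : ℝ) * (1 / 12) = 1 / 3 by norm_num]
  field_simp
  push_cast
  ring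

/-- The classical Willmore functional does not take a constant value on the
constant mean curvature spheres `S_H` in the Heisenberg group: there are two
values `H₁, H₂ > 0` of the mean curvature at which the Willmore integrals differ. -/
theorem willmore_not_constant_on_cmc_spheres_in_Nil :
    ∃ H₁ H₂ : ℝ, 0 < H₁ ∧ 0 < H₂ ∧
      2 * π * ∫ r in Ioi (0 : ℝ),
          (H₁ ^ 2 + 1 / 4 - ((r ^ 2 - 1) / (r ^ 2 + 1)) ^ 2) *
            (16 * (1 + 4 * H₁ ^ 2) * (1 + r ^ 2) ^ 2 /
              ((r ^ 2 - 1) ^ 2 + 4 * H₁ ^ 2 * (r ^ 2 + 1) ^ 2) ^ 2) * r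
      ≠ 2 * π * ∫ r in Ioi (0 : ℝ),
          (H₂ ^ 2 + 1 / 4 - ((r ^ 2 - 1) / (r ^ 2 + 1)) ^ 2) *
            (16 * (1 + 4 * H₂ ^ 2) * (1 + r ^ 2) ^ 2 /
              ((r ^ 2 - 1) ^ 2 + 4 * H₂ ^ 2 * (r ^ 2 + 1) ^ 2) ^ 2) * r := by
  have hH : (√3 / 6 : ℝ) ^ 2 = 1 / 12 := by
    rw [div_pow, sq_sqrt (by norm_num)]
    norm_num
  refine ⟨1 / 2, √3 / 6, by norm_num, by positivity, fun h ↦ ?_⟩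
  rw [willmore_integral_eq (by norm_num) hasDerivAt_willmore_antideriv_half,
    willmore_integral_eq (by positivity) (hasDerivAt_willmore_antideriv_twelfth hH)] at h
  have h' := mul_left_cancel₀ (by positivity) h
  rw [arctan_neg, arctan_one] at h'
  norm_num at h'
  linarith [pi_pos]
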